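/- At most two dyadic intervals of any given level are maximal dyadic subintervals of a half-open interval: for all a, b ∈ ℝ and n ∈ ℕ with n ≥ 1, the set {k ∈ ℤ : D(n,k) ⊆ [a,b) and ¬(D(n−1, ⌊k/2⌋) ⊆ [a,b))} is finite and has at most 2 elements. -/

import Mathlib

/-- The dyadic interval `D(n,k) = [k/2^n, (k+1)/2^n) ⊆ ℝ`. -/
def dyadic (n : ℕ) (k : ℤ) : Set ℝ :=
  Set.Ico ((k : ℝ) / 2 ^ n) (((k : ℝ) + 1) / 2 ^ n)

theorem dyadic_subset_Ico_iff (a b : ℝ) (n : ℕ) (k : ℤ) :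
    dyadic n k ⊆ Set.Ico a b ↔ ⌈a * 2 ^ n⌉ ≤ k ∧ k + 1 ≤ ⌊b * 2 ^ n⌋ := by
  have hpow : (0 : ℝ) < 2 ^ n := by positivity
  have hlt : (k : ℝ) / 2 ^ n < ((k : ℝ) + 1) / 2 ^ n := by gcongr; linarith
  rw [dyadic, Set.Ico_subset_Ico_iff hlt, le_div_iff₀ hpow, div_le_iff₀ hpow, Int.ceil_le,
    Int.le_floor]
  push_cast
  rfl

/-- Containment of an interval of level `n`, in terms of the grid of level `n + 1`. -/
theorem dyadic_subset_Ico_iff_succ (a b : ℝ) (n : ℕ) (k : ℤ) :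
    dyadic n k ⊆ Set.Ico a b ↔
      ⌈a * 2 ^ (n + 1)⌉ ≤ 2 * k ∧ 2 * k + 2 ≤ ⌊b * 2 ^ (n + 1)⌋ := by
  simp only [dyadic_subset_Ico_iff, Int.ceil_le, Int.le_floor, pow_succ]
  push_cast
  constructor <;> rintro ⟨h₁, h₂⟩ <;> constructor <;> linarith

theorem floor_intCast_div_two (k : ℤ) : ⌊(k : ℝ) / 2⌋ = k / 2 := by
  simpa using Int.floor_div_natCast (k : ℝ) 2

/-- A maximal dyadic subinterval of `[a, b)` is the leftmost or the rightmost one of its level. -/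
theorem dyadic_canonical_subset_pair (a b : ℝ) (n : ℕ) :
    {k : ℤ | dyadic (n + 1) k ⊆ Set.Ico a b ∧ ¬ dyadic n ⌊(k : ℝ) / 2⌋ ⊆ Set.Ico a b} ⊆
      {⌈a * 2 ^ (n + 1)⌉, ⌊b * 2 ^ (n + 1)⌋ - 1} := by
  rintro k ⟨hk, hparent⟩
  rw [dyadic_subset_Ico_iff] at hk
  rw [dyadic_subset_Ico_iff_succ, floor_intCast_div_two] at hparent
  rw [Set.mem_insert_iff, Set.mem_singleton_iff]
  omega

/-- At most two dyadic intervals of any given level are maximal dyadic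
subintervals of a half-open interval. -/
theorem dyadic_canonical_le_two (a b : ℝ) (n : ℕ) (hn : 1 ≤ n) :
    {k : ℤ | dyadic n k ⊆ Set.Ico a b ∧
        ¬ dyadic (n - 1) ⌊(k : ℝ) / 2⌋ ⊆ Set.Ico a b}.Finite ∧
      {k : ℤ | dyadic n k ⊆ Set.Ico a b ∧
        ¬ dyadic (n - 1) ⌊(k : ℝ) / 2⌋ ⊆ Set.Ico a b}.ncard ≤ 2 := by
  obtain ⟨m, rfl⟩ := Nat.exists_eq_add_of_le' hn
  have hsub := dyadic_canonical_subset_pair a b m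
  have hfin := Set.toFinite {⌈a * 2 ^ (m + 1)⌉, ⌊b * 2 ^ (m + 1)⌋ - 1}
  exact ⟨hfin.subset hsub, (Set.ncard_le_ncard hsub hfin).trans (Set.ncard_insert_le _ _|>.trans (by simp))⟩
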